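/- arXiv:1604.06878 — 3 statements merged into one kernel-verified Lean document; each statement's English description precedes it below -/
import Mathlib

section
/- Let C be a self-dual [54,27,10] binary code whose shadow S contains a vector of weight 3. Then C has at least 31 codewords of weight 10, and S contains at most 28 vectors of weight 7. -/
/-- The (Hamming) weight of a vector over `ZMod 2`. -/
def wt {ι : Type*} [Fintype ι] (x : ι → ZMod 2) : ℕ :=
  (Finset.univ.filter fun i => x i ≠ 0).card

/-- The dual code of a binary linear code. -/
def dualCode {ι : Type*} [Fintype ι] (C : Submodule (ZMod 2) (ι → ZMod 2)) :
    Submodule (ZMod 2) (ι → ZMod 2) where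
  carrier := {x | ∀ c ∈ C, ∑ i, x i * c i = 0}
  zero_mem' := by intro c _; simp
  add_mem' := by
    intro a b ha hb c hc
    simp only [Set.mem_setOf_eq] at ha hb ⊢
    simp [Pi.add_apply, add_mul, Finset.sum_add_distrib, ha c hc, hb c hc]
  smul_mem' := by
    intro r a ha c hc
    simp only [Set.mem_setOf_eq] at ha ⊢
    simp [Pi.smul_apply, smul_eq_mul, mul_assoc, ← Finset.mul_sum, ha c hc]

/-- A binary linear code is self-dual if it equals its dual. -/
def IsSelfDual {ι : Type*} [Fintype ι] (C : Submodule (ZMod 2) (ι → ZMod 2)) : Prop :=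
  C = dualCode C

/-- A binary code is even if every codeword has even weight. -/
def IsEvenCode {ι : Type*} [Fintype ι] (C : Submodule (ZMod 2) (ι → ZMod 2)) : Prop :=
  ∀ c ∈ C, 2 ∣ wt c

/-- `C` has minimum weight `d`: some nonzero codeword has weight `d` and
no nonzero codeword has smaller weight. -/
def HasMinWt {ι : Type*} [Fintype ι] (C : Submodule (ZMod 2) (ι → ZMod 2)) (d : ℕ) : Prop :=
  (∃ c ∈ C, c ≠ 0 ∧ wt c = d) ∧ ∀ c ∈ C, c ≠ 0 → d ≤ wt c

/-- `Awt C i` is the number `A_i(C)` of codewords of `C` of weight `i`. -/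
noncomputable def Awt {ι : Type*} [Fintype ι]
    (C : Submodule (ZMod 2) (ι → ZMod 2)) (i : ℕ) : ℕ :=
  Set.ncard {c ∈ (C : Set (ι → ZMod 2)) | wt c = i}

/-- `C` performs better than `C'`: the weight distribution of `C` is
lexicographically smaller than that of `C'`. -/
def LexSmaller {ι : Type*} [Fintype ι]
    (C C' : Submodule (ZMod 2) (ι → ZMod 2)) : Prop :=
  ∃ s : ℕ, (∀ i < s, Awt C i = Awt C' i) ∧ Awt C s < Awt C' s

/-- A circulant matrix: each row is the cyclic shift (by one position) of the previous one,
equivalently the matrix is invariant under simultaneously cyclically shifting rows and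
columns. -/
def IsCirculant {n : ℕ} (R : Matrix (Fin n) (Fin n) (ZMod 2)) : Prop :=
  ∀ i j k : Fin n, R (i + k) (j + k) = R i j

/-- The generator matrix `(I_n | R)`. -/
def genMat {n : ℕ} (R : Matrix (Fin n) (Fin n) (ZMod 2)) :
    Matrix (Fin n) (Fin n ⊕ Fin n) (ZMod 2) :=
  Matrix.of fun i => Sum.elim (fun j => if i = j then (1 : ZMod 2) else 0) (R i)

/-- The row space (span of the rows) of a matrix over `ZMod 2`. -/
def rowSpan {ι κ : Type*} (M : Matrix ι κ (ZMod 2)) : Submodule (ZMod 2) (κ → ZMod 2) :=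
  Submodule.span (ZMod 2) (Set.range M)

/-- The bordered matrix `B` with `B 0 0 = α`, the rest of the first row and first
column all ones, and remaining block the matrix `R'`. -/
def borderMat {m : ℕ} (α : ZMod 2) (R' : Matrix (Fin m) (Fin m) (ZMod 2)) :
    Matrix (Fin (m + 1)) (Fin (m + 1)) (ZMod 2) :=
  Matrix.of fun i j =>
    if hi : i = 0 then (if j = 0 then α else 1)
    else if hj : j = 0 then 1
    else R' (i.pred hi) (j.pred hj)

/-- `C` is a pure double circulant code of length `2n`. -/
def IsPureDC {n : ℕ} (C : Submodule (ZMod 2) (Fin n ⊕ Fin n → ZMod 2)) : Prop :=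
  ∃ R : Matrix (Fin n) (Fin n) (ZMod 2), IsCirculant R ∧ C = rowSpan (genMat R)

/-- `C` is a bordered double circulant code of length `2(m+1)`. -/
def IsBorderedDC {m : ℕ} (C : Submodule (ZMod 2) (Fin (m + 1) ⊕ Fin (m + 1) → ZMod 2)) : Prop :=
  ∃ (α : ZMod 2) (R' : Matrix (Fin m) (Fin m) (ZMod 2)),
    IsCirculant R' ∧ C = rowSpan (genMat (borderMat α R'))

/-- `C` is a double circulant code: pure or bordered. -/
def IsDC {m : ℕ} (C : Submodule (ZMod 2) (Fin (m + 1) ⊕ Fin (m + 1) → ZMod 2)) : Prop :=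
  IsPureDC C ∨ IsBorderedDC C

/-- The dual of a set of vectors. -/
def dualSet {ι : Type*} [Fintype ι] (X : Set (ι → ZMod 2)) : Set (ι → ZMod 2) :=
  {x | ∀ c ∈ X, ∑ i, x i * c i = 0}

/-- The shadow `S = C_0^⊥ \ C` of `C`, where `C_0` is the doubly even subcode. -/
def shadowSet {ι : Type*} [Fintype ι] (C : Submodule (ZMod 2) (ι → ZMod 2)) :
    Set (ι → ZMod 2) :=
  dualSet {c ∈ (C : Set (ι → ZMod 2)) | 4 ∣ wt c} \ (C : Set (ι → ZMod 2))

/-- The set of common nonzero coordinates of two binary vectors. -/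
def commonSupport {ι : Type*} [Fintype ι] (a b : ι → ZMod 2) : Finset ι :=
  Finset.univ.filter fun i => a i ≠ 0 ∧ b i ≠ 0

theorem wt_add_add_two_mul {ι : Type*} [Fintype ι] (a b : ι → ZMod 2) :
    wt (a + b) + 2 * (commonSupport a b).card = wt a + wt b := by
  simp only [wt, commonSupport, Finset.card_filter, Finset.mul_sum, ← Finset.sum_add_distrib]
  refine Finset.sum_congr rfl fun i _ => ?_
  rw [Pi.add_apply]
  generalize a i = x
  generalize b i = y
  revert x y
  decide

theorem sum_mul_eq_card {ι : Type*} [Fintype ι] (a b : ι → ZMod 2) :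
    ∑ i, a i * b i = ((commonSupport a b).card : ZMod 2) := by
  simp only [commonSupport, Finset.card_filter, Nat.cast_sum]
  refine Finset.sum_congr rfl fun i _ => ?_
  generalize a i = x
  generalize b i = y
  revert x y
  decide

theorem sum_mul_eq_zero_iff {ι : Type*} [Fintype ι] (a b : ι → ZMod 2) :
    ∑ i, a i * b i = 0 ↔ 2 ∣ (commonSupport a b).card := by
  rw [sum_mul_eq_card, ZMod.natCast_eq_zero_iff]

theorem sum_mul_self_eq_zero_iff {ι : Type*} [Fintype ι] (a : ι → ZMod 2) :
    ∑ i, a i * a i = 0 ↔ 2 ∣ wt a := by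
  rw [sum_mul_eq_zero_iff]
  simp [commonSupport, wt]

theorem wt_eq_zero_iff {ι : Type*} [Fintype ι] (a : ι → ZMod 2) : wt a = 0 ↔ a = 0 := by
  simp [wt, Finset.filter_eq_empty_iff, funext_iff]

theorem wt_le_card {ι : Type*} [Fintype ι] (a : ι → ZMod 2) : wt a ≤ Fintype.card ι :=
  Finset.card_le_univ _

theorem wt_add_one {ι : Type*} [Fintype ι] (a : ι → ZMod 2) :
    wt (a + 1) + wt a = Fintype.card ι := by
  simp only [wt, Finset.card_filter, ← Finset.card_univ]
  rw [Finset.card_eq_sum_ones, ← Finset.sum_add_distrib]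
  refine Finset.sum_congr rfl fun i _ => ?_
  rw [Pi.add_apply, Pi.one_apply]
  generalize a i = x
  revert x
  decide

theorem add_self_zmod_two {ι : Type*} (a : ι → ZMod 2) : a + a = 0 :=
  funext fun i => CharTwo.add_self_eq_zero (a i)

/-- The nontrivial character of `ZMod 2` with values in `ℤ`. -/
def sgn (a : ZMod 2) : ℤ := if a = 0 then 1 else -1

theorem sgn_add (a b : ZMod 2) : sgn (a + b) = sgn a * sgn b := by
  revert a b
  decide

theorem sgn_sum {ι : Type*} (s : Finset ι) (f : ι → ZMod 2) :
    sgn (∑ i ∈ s, f i) = ∏ i ∈ s, sgn (f i) := by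
  classical
  induction s using Finset.induction_on with
  | empty => simp [sgn]
  | insert a s ha ih => rw [Finset.sum_insert ha, Finset.prod_insert ha, sgn_add, ih]

/-- The Krawtchouk polynomial of degree `k` for length `n`, evaluated at `w`. -/
def krawtchouk (n k w : ℕ) : ℤ :=
  ∑ p ∈ Finset.HasAntidiagonal.antidiagonal k, ((n - w).choose p.1 : ℤ) * ((-1) ^ p.2 * (w.choose p.2 : ℤ))

open Polynomial in
theorem coeff_one_sub_X_pow_int (w k : ℕ) :
    ((1 - X : ℤ[X]) ^ w).coeff k = (-1) ^ k * (w.choose k : ℤ) := by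
  have h : (1 - X : ℤ[X]) ^ w = ((1 + X) ^ w).comp (C (-1) * X) := by
    simp [sub_eq_add_neg]
  rw [h, comp_C_mul_X_coeff, coeff_one_add_X_pow, mul_comm]

open Polynomial in
theorem sum_X_pow_wt {ι : Type*} [Fintype ι] [DecidableEq ι] (v : ι → ZMod 2) :
    ∑ t : ι → ZMod 2, C (sgn (∑ i, t i * v i)) * (X : ℤ[X]) ^ wt t =
      (1 + X) ^ (Fintype.card ι - wt v) * (1 - X) ^ wt v := by
  have h := Finset.prod_univ_sum (fun _ : ι => (Finset.univ : Finset (ZMod 2)))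
    (fun i a => C (sgn (a * v i)) * (X : ℤ[X]) ^ (if a ≠ 0 then 1 else 0))
  rw [Fintype.piFinset_univ] at h
  have hl : ∀ t : ι → ZMod 2, ∏ i, C (sgn (t i * v i)) * (X : ℤ[X]) ^ (if t i ≠ 0 then 1 else 0)
      = C (sgn (∑ i, t i * v i)) * (X : ℤ[X]) ^ wt t := by
    intro t
    rw [Finset.prod_mul_distrib, sgn_sum, map_prod, Finset.prod_pow_eq_pow_sum, wt,
      Finset.card_filter]
  simp only [hl] at h
  rw [← h]
  have hr : ∀ i, ∑ a : ZMod 2, C (sgn (a * v i)) * (X : ℤ[X]) ^ (if a ≠ 0 then 1 else 0)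
      = if v i ≠ 0 then 1 - X else 1 + X := by
    intro i
    have hs : ∀ f : ZMod 2 → ℤ[X], ∑ a : ZMod 2, f a = f 0 + f 1 := fun f => Fin.sum_univ_two f
    rw [hs]
    generalize v i = x
    obtain rfl | rfl : x = 0 ∨ x = 1 := by revert x; decide
    · simp [sgn]
    · simp [sgn, sub_eq_add_neg]
  simp only [hr]
  rw [Finset.prod_ite, Finset.prod_const, Finset.prod_const, mul_comm]
  congr 2
  have := Finset.card_filter_add_card_filter_not (s := (Finset.univ : Finset ι))
    (p := fun i => v i ≠ 0)
  rw [Finset.card_univ] at this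
  unfold wt
  omega

theorem sum_sgn_of_wt_eq {ι : Type*} [Fintype ι] [DecidableEq ι] (v : ι → ZMod 2) (k : ℕ) :
    ∑ t : ι → ZMod 2, (if wt t = k then sgn (∑ i, t i * v i) else 0) =
      krawtchouk (Fintype.card ι) k (wt v) := by
  have h := congrArg (fun p => Polynomial.coeff p k) (sum_X_pow_wt v)
  simp only [Polynomial.finsetSum_coeff, Polynomial.coeff_C_mul, Polynomial.coeff_X_pow] at h
  rw [Polynomial.coeff_mul] at h
  simp only [Polynomial.coeff_one_add_X_pow, coeff_one_sub_X_pow_int] at h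
  rw [krawtchouk]
  refine Eq.trans (Finset.sum_congr rfl fun t _ => ?_) h
  simp [eq_comm]

/-- Poisson summation over a coset of a binary code. -/
theorem sum_krawtchouk_coset {ι : Type*} [Fintype ι] [DecidableEq ι]
    (D : Submodule (ZMod 2) (ι → ZMod 2)) [DecidablePred (· ∈ D)]
    [DecidablePred (· ∈ dualCode D)] (s : ι → ZMod 2) (k : ℕ) :
    ∑ v ∈ Finset.univ.filter (· ∈ D), krawtchouk (Fintype.card ι) k (wt (s + v)) =
      (Finset.univ.filter (· ∈ D)).card *
        ∑ t ∈ Finset.univ.filter (· ∈ dualCode D),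
          if wt t = k then sgn (∑ i, t i * s i) else 0 := by
  simp only [← sum_sgn_of_wt_eq]
  rw [Finset.sum_comm, Finset.mul_sum, Finset.sum_filter]
  refine Finset.sum_congr rfl fun t _ => ?_
  by_cases hk : wt t = k
  swap
  · simp [hk]
  simp only [hk, if_true, Pi.add_apply, mul_add, Finset.sum_add_distrib, sgn_add]
  rw [← Finset.mul_sum]
  split_ifs with ht
  · have h1 : ∀ v ∈ Finset.univ.filter (· ∈ D), sgn (∑ i, t i * v i) = 1 := fun v hv => by
      rw [ht v (Finset.mem_filter.1 hv).2]
      rfl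
    rw [Finset.sum_congr rfl h1, Finset.sum_const, nsmul_one, mul_comm]
  · have : ∃ c ∈ D, ∑ i, t i * c i ≠ 0 := by
      by_contra! hc
      exact ht hc
    obtain ⟨c, hc, hn⟩ := this
    have hsum : ∑ v ∈ Finset.univ.filter (· ∈ D), sgn (∑ i, t i * v i) =
        ∑ v ∈ Finset.univ.filter (· ∈ D), -sgn (∑ i, t i * v i) := by
      refine Finset.sum_nbij' (· + c) (· + c) ?_ ?_ ?_ ?_ ?_
      · intro v hv
        simpa using D.add_mem (by simpa using hv) hc
      · intro v hv
        simpa using D.add_mem (by simpa using hv) hc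
      · intro v _
        rw [add_assoc, add_self_zmod_two, add_zero]
      · intro v _
        rw [add_assoc, add_self_zmod_two, add_zero]
      · intro v _
        simp only [Pi.add_apply, mul_add, Finset.sum_add_distrib, sgn_add]
        simp [sgn, hn]
    rw [Finset.sum_neg_distrib] at hsum
    have : ∑ v ∈ Finset.univ.filter (· ∈ D), sgn (∑ i, t i * v i) = 0 := by omega
    rw [this, mul_zero]

section SelfDual

variable {ι : Type*} [Fintype ι] {D : Submodule (ZMod 2) (ι → ZMod 2)}

theorem IsSelfDual.sum_mul_eq_zero (h : IsSelfDual D) {a b : ι → ZMod 2} (ha : a ∈ D)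
    (hb : b ∈ D) : ∑ i, a i * b i = 0 := by
  rw [h] at ha
  exact ha b hb

theorem IsSelfDual.two_dvd_wt (h : IsSelfDual D) {a : ι → ZMod 2} (ha : a ∈ D) : 2 ∣ wt a :=
  (sum_mul_self_eq_zero_iff a).1 (h.sum_mul_eq_zero ha ha)

theorem IsSelfDual.mem_of_forall (h : IsSelfDual D) {a : ι → ZMod 2}
    (ha : ∀ c ∈ D, ∑ i, a i * c i = 0) : a ∈ D := by
  rw [h]
  exact ha

theorem IsSelfDual.one_mem (h : IsSelfDual D) : (1 : ι → ZMod 2) ∈ D := by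
  refine h.mem_of_forall fun c hc => ?_
  rw [← h.sum_mul_eq_zero hc hc]
  refine Finset.sum_congr rfl fun i _ => ?_
  rw [Pi.one_apply]
  generalize c i = x
  revert x
  decide

/-- A shadow vector is orthogonal to exactly the doubly even codewords. -/
theorem sum_mul_eq_zero_iff_of_mem_shadowSet (h : IsSelfDual D) {v c : ι → ZMod 2}
    (hv : v ∈ shadowSet D) (hc : c ∈ D) : ∑ i, v i * c i = 0 ↔ 4 ∣ wt c := by
  refine ⟨fun h0 => ?_, fun h4 => hv.1 c ⟨hc, h4⟩⟩
  by_contra h4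
  refine hv.2 (h.mem_of_forall fun d hd => ?_)
  by_cases h4d : 4 ∣ wt d
  · exact hv.1 d ⟨hd, h4d⟩
  have h1 := (sum_mul_eq_zero_iff c d).1 (h.sum_mul_eq_zero hc hd)
  have h2 := wt_add_add_two_mul c d
  have h3 := h.two_dvd_wt hc
  have h3' := h.two_dvd_wt hd
  have h5 := hv.1 (c + d) ⟨D.add_mem hc hd, by omega⟩
  simpa only [Pi.add_apply, mul_add, Finset.sum_add_distrib, h0, zero_add] using h5

theorem mem_shadowSet_iff_add_mem (h : IsSelfDual D) {s v : ι → ZMod 2}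
    (hs : s ∈ shadowSet D) : v ∈ shadowSet D ↔ s + v ∈ D := by
  constructor
  · intro hv
    refine h.mem_of_forall fun c hc => ?_
    simp only [Pi.add_apply, add_mul, Finset.sum_add_distrib]
    have h1 := sum_mul_eq_zero_iff_of_mem_shadowSet h hs hc
    have h2 := sum_mul_eq_zero_iff_of_mem_shadowSet h hv hc
    have h12 := h1.trans h2.symm
    generalize ∑ i, s i * c i = x at h12
    generalize ∑ i, v i * c i = y at h12
    revert x y
    decide
  · intro hv
    refine ⟨fun c hc => ?_, fun hvD => ?_⟩
    · have h1 := h.sum_mul_eq_zero hv hc.1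
      simpa only [Pi.add_apply, add_mul, Finset.sum_add_distrib, hs.1 c hc, zero_add] using h1
    · refine hs.2 ?_
      have h1 := D.add_mem hv hvD
      rwa [add_assoc, add_self_zmod_two, add_zero] at h1

theorem wt_mod_four_of_mem_shadowSet (h : IsSelfDual D) {s v : ι → ZMod 2}
    (hs : s ∈ shadowSet D) (hv : v ∈ shadowSet D) : wt v % 4 = wt s % 4 := by
  have hc := (mem_shadowSet_iff_add_mem h hs).1 hv
  have h1 := wt_add_add_two_mul s (s + v)
  rw [← add_assoc, add_self_zmod_two, zero_add] at h1
  have h2 := sum_mul_eq_zero_iff_of_mem_shadowSet h hs hc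
  rw [sum_mul_eq_zero_iff] at h2
  have h3 := h.two_dvd_wt hc
  omega

theorem add_one_mem_shadowSet (h : IsSelfDual D) {v : ι → ZMod 2} (hv : v ∈ shadowSet D) :
    v + 1 ∈ shadowSet D := by
  rw [mem_shadowSet_iff_add_mem h hv, ← add_assoc, add_self_zmod_two, zero_add]
  exact h.one_mem

theorem ncard_shadowSet_wt_compl (h : IsSelfDual D) {j k : ℕ} (hjk : j + k = Fintype.card ι) :
    Set.ncard {v ∈ shadowSet D | wt v = j} = Set.ncard {v ∈ shadowSet D | wt v = k} := by
  refine Set.ncard_congr (fun v _ => v + 1) ?_ ?_ ?_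
  · rintro v ⟨hv, hw⟩
    have := wt_add_one v
    exact ⟨add_one_mem_shadowSet h hv, by omega⟩
  · intro a b _ _ hab
    exact add_right_cancel hab
  · rintro v ⟨hv, hw⟩
    have := wt_add_one v
    exact ⟨v + 1, ⟨add_one_mem_shadowSet h hv, by omega⟩,
      by rw [add_assoc, add_self_zmod_two, add_zero]⟩

end SelfDual

/-- The polynomial `∏ (w - r)` over `r = 11, 15, …, 43` (with `27` doubled), normalized and
expanded in Krawtchouk polynomials. -/
def shadowPoly (w : ℕ) : ℤ :=
  krawtchouk 54 10 w + 3 * krawtchouk 54 8 w - 3 * krawtchouk 54 6 w + 47 * krawtchouk 54 4 w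
    - 91 * krawtchouk 54 2 w + 351 * krawtchouk 54 0 w

theorem shadowPoly_eq {w : ℕ} (hw : w ≤ 54) (h4 : w % 4 = 3) :
    shadowPoly w = 2 ^ 27 * (48 * (if w = 3 then 1 else 0) + 4 * (if w = 7 then 1 else 0)
      + 4 * (if w = 47 then 1 else 0) + 48 * (if w = 51 then 1 else 0)) := by
  have key : ∀ j < 13, shadowPoly (4 * j + 3) = 2 ^ 27 * (48 * (if 4 * j + 3 = 3 then 1 else 0) +
      4 * (if 4 * j + 3 = 7 then 1 else 0) + 4 * (if 4 * j + 3 = 47 then 1 else 0)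
      + 48 * (if 4 * j + 3 = 51 then 1 else 0)) := by
    intro j hj
    simp only [shadowPoly, krawtchouk, Finset.Nat.sum_antidiagonal_eq_sum_range_succ_mk,
      Finset.sum_range_succ, Finset.sum_range_zero]
    interval_cases j <;> norm_num [Nat.choose]
  have := key (w / 4) (by omega)
  rwa [show 4 * (w / 4) + 3 = w by omega] at this

theorem card_filter_mem_eq_pow {ι : Type*} [Fintype ι] [DecidableEq ι]
    (D : Submodule (ZMod 2) (ι → ZMod 2)) [DecidablePred (· ∈ D)] :
    (Finset.univ.filter (· ∈ D)).card = 2 ^ Module.finrank (ZMod 2) D := by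
  have h := Module.card_eq_pow_finrank (K := ZMod 2) (V := D)
  rw [ZMod.card] at h
  exact (Fintype.card_of_subtype _ (by simp)).symm.trans h

section WeightThree

variable {ι : Type*} [Fintype ι] {D : Submodule (ZMod 2) (ι → ZMod 2)}

theorem ncard_shadowSet_wt_three (h : IsSelfDual D) (hmin : ∀ c ∈ D, c ≠ 0 → 10 ≤ wt c)
    {s : ι → ZMod 2} (hs : s ∈ shadowSet D) (hs3 : wt s = 3) :
    Set.ncard {v ∈ shadowSet D | wt v = 3} = 1 := by
  rw [Set.ncard_eq_one]
  refine ⟨s, Set.ext fun v => ⟨fun ⟨hv, hv3⟩ => ?_, fun hv => hv ▸ ⟨hs, hs3⟩⟩⟩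
  by_contra hne
  have h1 := hmin _ ((mem_shadowSet_iff_add_mem h hs).1 hv) fun h0 => hne ?_
  · have := wt_add_add_two_mul s v
    omega
  · have := congrArg (s + ·) h0
    simpa [← add_assoc, add_self_zmod_two] using this

theorem ncard_shadowSet_wt_seven_le (h : IsSelfDual D) (hmin : ∀ c ∈ D, c ≠ 0 → 10 ≤ wt c)
    {s : ι → ZMod 2} (hs : s ∈ shadowSet D) (hs3 : wt s = 3) :
    Set.ncard {v ∈ shadowSet D | wt v = 7} ≤ Awt D 10 := by
  refine Set.ncard_le_ncard_of_injOn (s + ·) ?_ (fun a _ b _ hab => add_left_cancel hab)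
    (Set.toFinite _)
  rintro v ⟨hv, hv7⟩
  have hc := (mem_shadowSet_iff_add_mem h hs).1 hv
  refine ⟨hc, ?_⟩
  have h2 := wt_add_add_two_mul s v
  have h1 := hmin _ hc fun h0 => by
    have := congrArg (s + ·) h0
    simp only [← add_assoc, add_self_zmod_two, zero_add, add_zero] at this
    rw [this] at hv7
    omega
  change wt (s + v) = 10
  omega

theorem Awt_ten_add (hι : Fintype.card ι = 54) (h : IsSelfDual D) (hdim : Module.finrank (ZMod 2) D = 27)
    (hmin : ∀ c ∈ D, c ≠ 0 → 10 ≤ wt c)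
    {s : ι → ZMod 2} (hs : s ∈ shadowSet D) (hs3 : wt s = 3) :
    Awt D 10 + 8 * Set.ncard {v ∈ shadowSet D | wt v = 7} = 255 := by
  classical
  have hshadow (j : ℕ) : ∑ v ∈ Finset.univ.filter (· ∈ D), (if wt (s + v) = j then (1 : ℤ) else 0)
      = Set.ncard {v ∈ shadowSet D | wt v = j} := by
    rw [Finset.sum_boole, Finset.filter_filter, ← Set.ncard_coe_finset]
    congr 1
    refine Set.ncard_congr (fun v _ => s + v) ?_ (fun a b _ _ hab => add_left_cancel hab) ?_
    · intro v hv
      simp only [Finset.coe_filter, Finset.mem_univ, true_and, Set.mem_ofPred_eq] at hv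
      refine ⟨(mem_shadowSet_iff_add_mem h hs).2 ?_, hv.2⟩
      rw [← add_assoc, add_self_zmod_two, zero_add]
      exact hv.1
    · rintro v ⟨hv, hj⟩
      refine ⟨s + v, ?_, by rw [← add_assoc, add_self_zmod_two, zero_add]⟩
      simp only [Finset.coe_filter, Finset.mem_univ, true_and, Set.mem_ofPred_eq]
      refine ⟨(mem_shadowSet_iff_add_mem h hs).1 hv, ?_⟩
      rw [← add_assoc, add_self_zmod_two, zero_add]
      exact hj
  have hleft : ∑ v ∈ Finset.univ.filter (· ∈ D), shadowPoly (wt (s + v)) =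
      2 ^ 27 * (96 + 8 * Set.ncard {v ∈ shadowSet D | wt v = 7}) := by
    have h4 : ∀ v ∈ Finset.univ.filter (· ∈ D), wt (s + v) % 4 = 3 := by
      intro v hv
      have hv' : s + v ∈ shadowSet D := by
        rw [mem_shadowSet_iff_add_mem h hs, ← add_assoc, add_self_zmod_two, zero_add]
        exact (Finset.mem_filter.1 hv).2
      rw [wt_mod_four_of_mem_shadowSet h hs hv', hs3]
    rw [Finset.sum_congr rfl fun v hv => shadowPoly_eq (hι ▸ wt_le_card (s + v)) (h4 v hv),
      ← Finset.mul_sum]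
    simp only [Finset.sum_add_distrib, ← Finset.mul_sum, hshadow]
    rw [ncard_shadowSet_wt_compl h (j := 47) (k := 7) (by omega),
      ncard_shadowSet_wt_compl h (j := 51) (k := 3) (by omega),
      ncard_shadowSet_wt_three h hmin hs hs3]
    push_cast
    ring
  have hzero : ∀ k, 0 < k → k < 10 →
      ∑ t ∈ Finset.univ.filter (· ∈ D), (if wt t = k then sgn (∑ i, t i * s i) else 0) = 0 := by
    intro k hk hk'
    refine Finset.sum_eq_zero fun t ht => if_neg fun hw => ?_
    have := hmin t (Finset.mem_filter.1 ht).2 fun h0 => by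
      rw [(wt_eq_zero_iff t).2 h0] at hw
      omega
    omega
  have hone : ∑ t ∈ Finset.univ.filter (· ∈ D),
      (if wt t = 0 then sgn (∑ i, t i * s i) else 0) = 1 := by
    simp only [wt_eq_zero_iff]
    rw [Finset.sum_ite_eq' _ (0 : ι → ZMod 2) fun t => sgn (∑ i, t i * s i)]
    simp [sgn]
  have hten : ∑ t ∈ Finset.univ.filter (· ∈ D),
      (if wt t = 10 then sgn (∑ i, t i * s i) else 0) = -(Awt D 10 : ℤ) := by
    have hterm : ∀ t ∈ Finset.univ.filter (· ∈ D),
        (if wt t = 10 then sgn (∑ i, t i * s i) else 0) = -(if wt t = 10 then (1 : ℤ) else 0) := by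
      intro t ht
      split_ifs with hw
      · have := (sum_mul_eq_zero_iff_of_mem_shadowSet h hs (Finset.mem_filter.1 ht).2).not.2
          (by omega)
        rw [Finset.sum_congr rfl fun i _ => mul_comm (t i) (s i), sgn, if_neg this]
      · simp
    rw [Finset.sum_congr rfl hterm, Finset.sum_neg_distrib, Finset.sum_boole,
      Finset.filter_filter, Awt, ← Set.ncard_coe_finset]
    simp
  have hP := sum_krawtchouk_coset D s
  have hdual : Finset.univ.filter (· ∈ dualCode D) = Finset.univ.filter (· ∈ D) := by
    rw [← h]
  simp only [hdual, card_filter_mem_eq_pow, hdim, hι] at hP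
  simp only [shadowPoly, Finset.sum_add_distrib, Finset.sum_sub_distrib, ← Finset.mul_sum, hP,
    hone, hten, hzero 2 (by norm_num) (by norm_num), hzero 4 (by norm_num) (by norm_num),
    hzero 6 (by norm_num) (by norm_num), hzero 8 (by norm_num) (by norm_num)] at hleft
  norm_num at hleft
  omega

end WeightThree

/-- A self-dual `[54, 27, 10]` code whose shadow contains a weight-3 vector
has at least 31 codewords of weight 10 and at most 28 weight-7 shadow vectors. -/
theorem stmt_4 (C : Submodule (ZMod 2) (Fin 54 → ZMod 2))
    (hsd : IsSelfDual C) (hdim : Module.finrank (ZMod 2) C = 27)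
    (hmin : HasMinWt C 10)
    (h3 : ∃ s ∈ shadowSet C, wt s = 3) :
    31 ≤ Awt C 10 ∧ Set.ncard {s ∈ shadowSet C | wt s = 7} ≤ 28 := by
  obtain ⟨s, hs, hs3⟩ := h3
  have h1 := ncard_shadowSet_wt_seven_le hsd hmin.2 hs hs3
  have h2 := Awt_ten_add (Fintype.card_fin 54) hsd hdim hmin.2 hs hs3
  omega
end

section
/- Let C be a self-dual binary code of length 54 with minimum weight 10 and shadow S, and suppose S contains a vector of weight 3. Then the number of codewords of C of weight 10 is at least the number of vectors of weight 7 in S. -/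
section WeightLemmas

variable {ι : Type*} [Fintype ι]

theorem ZMod.two_eq_zero_or_one (a : ZMod 2) : a = 0 ∨ a = 1 := by
  revert a; decide

theorem wt_cast_eq_sum (x : ι → ZMod 2) : (wt x : ZMod 2) = ∑ i, x i := by
  rw [wt, Finset.card_filter, Nat.cast_sum]
  refine Finset.sum_congr rfl fun i _ => ?_
  rcases ZMod.two_eq_zero_or_one (x i) with h | h <;> simp [h]

theorem wt_add_add_two_mul_wt_mul (x y : ι → ZMod 2) :
    wt (x + y) + 2 * wt (x * y) = wt x + wt y := by
  simp only [wt, Finset.card_filter, Finset.mul_sum, ← Finset.sum_add_distrib, Pi.add_apply,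
    Pi.mul_apply]
  refine Finset.sum_congr rfl fun i _ => ?_
  generalize x i = a
  generalize y i = b
  revert a b
  decide

theorem two_dvd_wt_mul_iff (x y : ι → ZMod 2) : 2 ∣ wt (x * y) ↔ ∑ i, x i * y i = 0 := by
  rw [← ZMod.natCast_eq_zero_iff, wt_cast_eq_sum]
  rfl

theorem IsSelfDual.mem_iff {C : Submodule (ZMod 2) (ι → ZMod 2)} (hC : IsSelfDual C)
    {x : ι → ZMod 2} : x ∈ C ↔ ∀ c ∈ C, ∑ i, x i * c i = 0 := by
  conv_lhs => rw [hC]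
  rfl

theorem IsSelfDual.isEvenCode {C : Submodule (ZMod 2) (ι → ZMod 2)} (hC : IsSelfDual C) :
    IsEvenCode C := by
  intro c hc
  have hcc : c * c = c := by
    ext i
    rcases ZMod.two_eq_zero_or_one (c i) with h | h <;> simp [h]
  have h := (two_dvd_wt_mul_iff c c).2 (hC.mem_iff.1 hc c hc)
  rwa [hcc] at h

/-- A shadow vector is not orthogonal to any codeword of singly even weight. -/
theorem IsSelfDual.sum_mul_eq_one_of_mem_shadowSet {C : Submodule (ZMod 2) (ι → ZMod 2)}
    (hC : IsSelfDual C) {s c : ι → ZMod 2} (hs : s ∈ shadowSet C) (hc : c ∈ C)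
    (hc4 : ¬ 4 ∣ wt c) : ∑ i, s i * c i = 1 := by
  obtain ⟨hs0, hsC⟩ := hs
  rw [SetLike.mem_coe, hC.mem_iff] at hsC
  push Not at hsC
  obtain ⟨d, hd, hsd⟩ := hsC
  have hd4 : ¬ 4 ∣ wt d := fun h => hsd (hs0 d ⟨hd, h⟩)
  have hsum : 4 ∣ wt (c + d) := by
    have h1 := wt_add_add_two_mul_wt_mul c d
    have h2 := (two_dvd_wt_mul_iff c d).2 (hC.mem_iff.1 hc d hd)
    have h3 := hC.isEvenCode c hc
    have h4 := hC.isEvenCode d hd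
    omega
  have h := hs0 (c + d) ⟨C.add_mem hc hd, hsum⟩
  simp only [Pi.add_apply, mul_add, Finset.sum_add_distrib] at h
  rw [(ZMod.two_eq_zero_or_one _).resolve_left hsd] at h
  rw [CharTwo.add_eq_zero] at h
  exact h

/-- The sum of two shadow vectors is a codeword. -/
theorem IsSelfDual.add_mem_of_mem_shadowSet {C : Submodule (ZMod 2) (ι → ZMod 2)}
    (hC : IsSelfDual C) {s t : ι → ZMod 2} (hs : s ∈ shadowSet C) (ht : t ∈ shadowSet C) :
    s + t ∈ C := by
  rw [hC.mem_iff]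
  intro c hc
  simp only [Pi.add_apply, add_mul, Finset.sum_add_distrib]
  by_cases hc4 : 4 ∣ wt c
  · rw [hs.1 c ⟨hc, hc4⟩, ht.1 c ⟨hc, hc4⟩, add_zero]
  · rw [hC.sum_mul_eq_one_of_mem_shadowSet hs hc hc4,
      hC.sum_mul_eq_one_of_mem_shadowSet ht hc hc4, CharTwo.add_self_eq_zero]

end WeightLemmas

/-- If a self-dual code of length 54 with minimum weight 10 has a weight-3
vector in its shadow, then `A_10` is at least the number of weight-7 shadow vectors. -/
theorem stmt_5 (C : Submodule (ZMod 2) (Fin 54 → ZMod 2))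
    (hsd : IsSelfDual C) (hmin : HasMinWt C 10)
    (h3 : ∃ s ∈ shadowSet C, wt s = 3) :
    Set.ncard {s ∈ shadowSet C | wt s = 7} ≤ Awt C 10 := by
  obtain ⟨s, hs, hs3⟩ := h3
  refine Set.ncard_le_ncard_of_injOn (fun t => s + t) ?_ (add_right_injective s).injOn
    (Set.toFinite _)
  rintro t ⟨ht, ht7⟩
  have hmem := hsd.add_mem_of_mem_shadowSet hs ht
  have hwt := wt_add_add_two_mul_wt_mul s t
  have hne : s + t ≠ 0 := by
    intro h
    rw [CharTwo.add_eq_zero] at h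
    rw [h, ht7] at hs3
    omega
  have hle := hmin.2 _ hmem hne
  exact ⟨hmem, by omega⟩
end

section
/- Every doubly even self-dual binary [88,44] code with minimum weight 16 has exactly 32164 codewords of weight 16, exactly 6992832 codewords of weight 20, and exactly 535731625 codewords of weight 24. -/
/-- The nontrivial additive character of `ZMod 2`. -/
def signChar : AddChar (ZMod 2) ℚ :=
  AddChar.zmodChar 2 (ζ := -1) (by norm_num)

lemma signChar_one : signChar 1 = -1 := by
  simp [signChar, AddChar.zmodChar_apply, ZMod.val_one]

lemma signChar_sum {ι : Type*} (s : Finset ι) (f : ι → ZMod 2) :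
    signChar (∑ i ∈ s, f i) = ∏ i ∈ s, signChar (f i) :=
  map_prod signChar.toMonoidHom (fun i => Multiplicative.ofAdd (f i)) s

lemma pow_wt {ι : Type*} [Fintype ι] (y : ℚ) (v : ι → ZMod 2) :
    y ^ wt v = ∏ i, if v i = 0 then 1 else y := by
  simp [wt, Finset.prod_ite]

/-- The Fourier transform of `v ↦ y ^ wt v` at `u`. -/
lemma sum_signChar_mul_pow_wt {ι : Type*} [Fintype ι] [DecidableEq ι] (y : ℚ)
    (u : ι → ZMod 2) :
    ∑ v : ι → ZMod 2, signChar (∑ i, v i * u i) * y ^ wt v =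
      (1 + y) ^ (Fintype.card ι - wt u) * (1 - y) ^ wt u := by
  have hcoord (a : ZMod 2) : ∑ b : ZMod 2, signChar (b * a) * (if b = 0 then 1 else y) =
      if a = 0 then 1 + y else 1 - y := by
    have huniv : (Finset.univ : Finset (ZMod 2)) = {0, 1} := by decide
    obtain rfl | rfl : a = 0 ∨ a = 1 := by
      revert a
      decide
    all_goals simp [huniv, signChar_one, sub_eq_add_neg]
  have hcard : (Finset.univ.filter fun i => u i = 0).card = Fintype.card ι - wt u := by
    have := Finset.card_filter_add_card_filter_not (s := Finset.univ) (fun i => u i = 0)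
    rw [Finset.card_univ] at this
    simp only [wt, ne_eq]
    omega
  calc
    _ = ∑ v : ι → ZMod 2, ∏ i, signChar (v i * u i) * (if v i = 0 then 1 else y) := by
      simp only [Finset.prod_mul_distrib, pow_wt, signChar_sum]
    _ = ∏ i, ∑ b : ZMod 2, signChar (b * u i) * (if b = 0 then 1 else y) := by
      rw [Finset.prod_univ_sum, Fintype.piFinset_univ]
    _ = _ := by
      simp only [hcoord, Finset.prod_ite, Finset.prod_const, hcard, wt, ne_eq]

/-- Orthogonality of characters on a binary linear code. -/
lemma sum_signChar_code {ι : Type*} [Fintype ι] (C : Submodule (ZMod 2) (ι → ZMod 2))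
    [Fintype C] (v : ι → ZMod 2) [Decidable (v ∈ dualCode C)] :
    ∑ u : C, signChar (∑ i, v i * (u : ι → ZMod 2) i) =
      if v ∈ dualCode C then (Fintype.card C : ℚ) else 0 := by
  split_ifs with h
  · simp [fun u : C => h u u.2]
  · obtain ⟨u₀, hu₀, hne⟩ : ∃ c ∈ C, ∑ i, v i * c i ≠ 0 := by
      by_contra! hall
      exact h hall
    have hone : ∑ i, v i * u₀ i = 1 := Fin.eq_one_of_ne_zero _ hne
    have key := Fintype.sum_equiv (Equiv.addLeft (⟨u₀, hu₀⟩ : C))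
      (fun u : C => signChar (∑ i, v i * (u₀ + (u : ι → ZMod 2)) i))
      (fun u : C => signChar (∑ i, v i * (u : ι → ZMod 2) i)) (fun _ => rfl)
    simp only [Pi.add_apply, mul_add, Finset.sum_add_distrib, hone, AddChar.map_add_eq_mul,
      signChar_one, neg_mul, one_mul, Finset.sum_neg_distrib] at key
    linarith

/-- The MacWilliams identity. -/
theorem macWilliams {ι : Type*} [Fintype ι] [DecidableEq ι]
    (C : Submodule (ZMod 2) (ι → ZMod 2)) [Fintype C] [Fintype (dualCode C)] (y : ℚ) :
    ∑ u : C, (1 + y) ^ (Fintype.card ι - wt (u : ι → ZMod 2)) *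
        (1 - y) ^ wt (u : ι → ZMod 2) =
      Fintype.card C * ∑ v : dualCode C, y ^ wt (v : ι → ZMod 2) := by
  classical
  simp only [← sum_signChar_mul_pow_wt]
  rw [Finset.sum_comm]
  simp only [← Finset.sum_mul, sum_signChar_code, ite_mul, zero_mul]
  rw [← Finset.sum_filter, Finset.mul_sum]
  exact Finset.sum_subtype _ (by simp) _

/-- A sum over codewords depending only on the weight, in terms of the weight distribution. -/
lemma sum_wt_eq_sum_Awt {ι : Type*} [Fintype ι] (C : Submodule (ZMod 2) (ι → ZMod 2))
    [Fintype C] (f : ℕ → ℚ) :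
    ∑ u : C, f (wt (u : ι → ZMod 2)) =
      ∑ w ∈ Finset.range (Fintype.card ι + 1), Awt C w * f w := by
  classical
  have hmaps (u : C) (_ : u ∈ Finset.univ) :
      wt (u : ι → ZMod 2) ∈ Finset.range (Fintype.card ι + 1) :=
    Finset.mem_range_succ_iff.2 (Finset.card_le_univ _)
  rw [← Finset.sum_fiberwise_of_maps_to hmaps]
  refine Finset.sum_congr rfl fun w _ => ?_
  have hA : Awt C w = (Finset.univ.filter fun u : C => wt (u : ι → ZMod 2) = w).card := by
    rw [← Set.ncard_coe_finset, ← Set.ncard_image_of_injective _ Subtype.val_injective, Awt]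
    congr 1
    ext x
    simp [and_comm]
  rw [hA, ← nsmul_eq_mul, ← Finset.sum_const]
  exact Finset.sum_congr rfl fun u hu => by rw [(Finset.mem_filter.1 hu).2]

/-- The MacWilliams identity for a self-dual code, in terms of its weight distribution. -/
theorem IsSelfDual.macWilliams {ι : Type*} [Fintype ι]
    {C : Submodule (ZMod 2) (ι → ZMod 2)} (hC : IsSelfDual C) (y : ℚ) :
    ∑ w ∈ Finset.range (Fintype.card ι + 1),
        Awt C w * ((1 + y) ^ (Fintype.card ι - w) * (1 - y) ^ w) =
      2 ^ Module.finrank (ZMod 2) C *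
        ∑ w ∈ Finset.range (Fintype.card ι + 1), Awt C w * y ^ w := by
  classical
  have := Fintype.ofFinite C
  have := Fintype.ofFinite (dualCode C)
  have hdual : ∑ v : dualCode C, y ^ wt (v : ι → ZMod 2) =
      ∑ v : C, y ^ wt (v : ι → ZMod 2) :=
    Fintype.sum_equiv (Equiv.subtypeEquivRight fun _ => by rw [← hC]) _ _ fun _ => rfl
  have h := _root_.macWilliams C y
  rw [hdual, Module.card_eq_pow_finrank (K := ZMod 2) (V := C), ZMod.card] at h
  rw [sum_wt_eq_sum_Awt C (fun w => (1 + y) ^ (Fintype.card ι - w) * (1 - y) ^ w),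
    sum_wt_eq_sum_Awt C (fun w => y ^ w)] at h
  exact_mod_cast h

lemma natCast_wt {ι : Type*} [Fintype ι] (x : ι → ZMod 2) : (wt x : ZMod 2) = ∑ i, x i := by
  rw [wt, Finset.card_filter, Nat.cast_sum]
  refine Finset.sum_congr rfl fun i _ => ?_
  generalize x i = a
  revert a
  decide

/-- An even self-dual code contains the all-ones vector. -/
lemma IsSelfDual.one_mem_s8 {ι : Type*} [Fintype ι] {C : Submodule (ZMod 2) (ι → ZMod 2)}
    (hC : IsSelfDual C) (heven : IsEvenCode C) : 1 ∈ C := by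
  rw [hC]
  intro c hc
  simpa [← natCast_wt] using (ZMod.natCast_eq_zero_iff _ 2).2 (heven c hc)

lemma wt_one_add {ι : Type*} [Fintype ι] (x : ι → ZMod 2) :
    wt (1 + x) = Fintype.card ι - wt x := by
  have hne (a : ZMod 2) : 1 + a ≠ 0 ↔ ¬a ≠ 0 := by
    revert a
    decide
  have := Finset.card_filter_add_card_filter_not (s := Finset.univ) (fun i => x i ≠ 0)
  rw [Finset.card_univ] at this
  simp only [wt, Pi.add_apply, Pi.one_apply, hne]
  omega

/-- Complementation makes the weight distribution symmetric. -/
lemma Awt_compl {ι : Type*} [Fintype ι] {C : Submodule (ZMod 2) (ι → ZMod 2)}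
    (hone : 1 ∈ C) {w : ℕ} (hw : w ≤ Fintype.card ι) :
    Awt C (Fintype.card ι - w) = Awt C w := by
  rw [Awt, Awt, ← Set.ncard_image_of_injective _ (add_right_injective (1 : ι → ZMod 2))]
  have hle (x : ι → ZMod 2) : wt x ≤ Fintype.card ι := Finset.card_le_univ _
  have hinv (x : ι → ZMod 2) : 1 + (1 + x) = x := by
    funext i
    exact CharTwo.add_cancel_left 1 (x i)
  congr 1
  ext x
  simp only [Set.mem_image, Set.mem_ofPred_eq, SetLike.mem_coe]
  constructor
  · rintro ⟨y, ⟨hy, hyw⟩, rfl⟩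
    exact ⟨C.add_mem hone hy, by rw [wt_one_add]; omega⟩
  · rintro ⟨hx, hxw⟩
    exact ⟨1 + x, ⟨C.add_mem hone hx, by rw [wt_one_add, hxw]⟩, hinv x⟩

lemma Awt_eq_zero {ι : Type*} [Fintype ι] {C : Submodule (ZMod 2) (ι → ZMod 2)} {w : ℕ}
    (h : ∀ c ∈ C, wt c ≠ w) : Awt C w = 0 := by
  rw [Awt, Set.ncard_eq_zero (Set.toFinite _)]
  exact Set.eq_empty_of_forall_notMem fun c hc => h c hc.1 hc.2

lemma Awt_zero {ι : Type*} [Fintype ι] (C : Submodule (ZMod 2) (ι → ZMod 2)) :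
    Awt C 0 = 1 := by
  rw [Awt, Set.ncard_eq_one]
  refine ⟨0, ?_⟩
  ext x
  simp only [Set.mem_ofPred_eq, SetLike.mem_coe, Set.mem_singleton_iff]
  constructor
  · rintro ⟨_, hx⟩
    funext i
    by_contra hi
    exact (Finset.card_pos.2 ⟨i, by simpa using hi⟩).ne' hx
  · rintro rfl
    simp [wt]

/-- Every doubly even self-dual `[88, 44]` code with minimum weight 16 has
exactly 32164 codewords of weight 16, 6992832 of weight 20, and 535731625 of weight 24. -/
theorem stmt_8 (C : Submodule (ZMod 2) (Fin 88 → ZMod 2))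
    (hsd : IsSelfDual C) (hdim : Module.finrank (ZMod 2) C = 44)
    (hde : ∀ c ∈ C, 4 ∣ wt c) (hmin : HasMinWt C 16) :
    Awt C 16 = 32164 ∧ Awt C 20 = 6992832 ∧ Awt C 24 = 535731625 := by
  have hone : 1 ∈ C := hsd.one_mem_s8 fun c hc => (by norm_num : 2 ∣ 4).trans (hde c hc)
  have hsymm (w : ℕ) (hw : w ≤ 88) : Awt C (88 - w) = Awt C w := by
    simpa using Awt_compl hone (w := w) (by simpa using hw)
  have hdvd (w : ℕ) (hw : ¬4 ∣ w) : Awt C w = 0 :=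
    Awt_eq_zero fun c hc h => hw (h ▸ hde c hc)
  have hsmall (w : ℕ) (hpos : 0 < w) (hw : w < 16) : Awt C w = 0 := by
    refine Awt_eq_zero fun c hc h => ?_
    have hc0 : c ≠ 0 := by
      rintro rfl
      simp [wt] at h
      omega
    have := hmin.2 c hc hc0
    omega
  have hsum (g : ℕ → ℚ) : ∑ w ∈ Finset.range 89, Awt C w * g w =
      (g 0 + g 88) + Awt C 16 * (g 16 + g 72) + Awt C 20 * (g 20 + g 68) +
      Awt C 24 * (g 24 + g 64) + Awt C 28 * (g 28 + g 60) + Awt C 32 * (g 32 + g 56) +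
      Awt C 36 * (g 36 + g 52) + Awt C 40 * (g 40 + g 48) + Awt C 44 * g 44 := by
    have hsub : ({0, 16, 20, 24, 28, 32, 36, 40, 44, 48, 52, 56, 60, 64, 68, 72, 88} : Finset ℕ) ⊆
        Finset.range 89 := by decide
    rw [← Finset.sum_subset hsub]
    · have h0 := Awt_zero C
      have h88 := hsymm 0 (by norm_num)
      have h72 := hsymm 16 (by norm_num)
      have h68 := hsymm 20 (by norm_num)
      have h64 := hsymm 24 (by norm_num)
      have h60 := hsymm 28 (by norm_num)
      have h56 := hsymm 32 (by norm_num)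
      have h52 := hsymm 36 (by norm_num)
      have h48 := hsymm 40 (by norm_num)
      norm_num at h88 h72 h68 h64 h60 h56 h52 h48
      simp [h0, h88, h72, h68, h64, h60, h56, h52, h48]
      ring
    · intro w hw hw'
      have hA : Awt C w = 0 := by
        by_cases h4 : 4 ∣ w
        · simp only [Finset.mem_range, Finset.mem_insert, Finset.mem_singleton] at hw hw'
          by_cases h16 : w < 16
          · exact hsmall w (by omega) h16
          · rw [← hsymm w (by omega)]
            exact hsmall _ (by omega) (by omega)
        · exact hdvd w h4
      simp [hA]
  have heq (y : ℚ) := hsd.macWilliams y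
  simp only [hdim, Fintype.card_fin, Nat.reduceAdd, hsum] at heq
  have e0 := heq 0
  have e2 := heq 2
  have e4 := heq 4
  have e5 := heq 5
  have e6 := heq 6
  have e7 := heq 7
  have e8 := heq 8
  have e9 := heq 9
  clear heq hsum
  norm_num at e0 e2 e4 e5 e6 e7 e8 e9
  have a16 : (Awt C 16 : ℚ) = 32164 := by linarith
  have a20 : (Awt C 20 : ℚ) = 6992832 := by linarith
  have a24 : (Awt C 24 : ℚ) = 535731625 := by linarith
  exact ⟨by exact_mod_cast a16, by exact_mod_cast a20, by exact_mod_cast a24⟩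
end
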